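/- Let M be a ring, G, C, B, P ∈ M with P = C*G*B (the plant P₂₂ = C₂(zI−A)⁻¹B₂ with G = (zI−A)⁻¹). Suppose R, Mm, N, L ∈ M satisfy the system-level constraints G⁻¹*R − B*Mm = 1·G⁻¹-form written as: R = G + G*B*Mm·(stated as (zI−A)R − B₂M = I and R(zI−A) − N C₂ = I), i.e., assume R*G⁻¹ − N*C = 1, G⁻¹*R − B*Mm = 1 (with G invertible), G⁻¹*N = B*L, and Mm*G⁻¹ = L*C... Concretely: assume G is invertible and (G⁻¹)*R − B*Mm = 1, R*(G⁻¹) − N*C = 1, G⁻¹*N − B*L = 0, Mm*G⁻¹ − L*C = 0. Define Y := C*N + 1, U := L, W := C*R*B, Z := Mm*B + 1. Then Y − P*U = 1, W − P*Z = 0, Y*P − W = 0, and Z − U*P = 1. -/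

import Mathlib

/-- Theorem 2, part 1 (SLP → IOP): if `(R, Mm, N, L)` satisfy the system-level affine
constraints (with `G = (zI−A)⁻¹` a unit, `P = C*G*B`), then `Y := C*N + 1`, `U := L`,
`W := C*R*B`, `Z := Mm*B + 1` satisfy the input-output affine constraints. -/
theorem slp_to_iop {M : Type*} [Ring M] (G B C R Mm N L : M) [Invertible G]
    (P : M) (hP : P = C * G * B)
    (h1 : ⅟G * R - B * Mm = 1) (h2 : R * ⅟G - N * C = 1)
    (h3 : ⅟G * N - B * L = 0) (h4 : Mm * ⅟G - L * C = 0)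
    (Y U W Z : M)
    (hY : Y = C * N + 1) (hU : U = L) (hW : W = C * R * B) (hZ : Z = Mm * B + 1) :
    Y - P * U = 1 ∧ W - P * Z = 0 ∧ Y * P - W = 0 ∧ Z - U * P = 1 := by
  have hN : N = G * (B * L) := by
    rw [← sub_eq_zero.mp h3, mul_invOf_cancel_left]
  have hM : Mm = L * C * G := by
    rw [← sub_eq_zero.mp h4, invOf_mul_cancel_right]
  have hR₁ : R = G * (1 + B * Mm) := by
    rw [← sub_eq_iff_eq_add.mp h1, mul_invOf_cancel_left]
  have hR₂ : R = (1 + N * C) * G := by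
    rw [← sub_eq_iff_eq_add.mp h2, invOf_mul_cancel_right]
  subst hP hY hU hW hZ
  refine ⟨?_, ?_, ?_, ?_⟩
  · rw [hN]; noncomm_ring
  · rw [hR₁]; noncomm_ring
  · rw [hR₂]; noncomm_ring
  · rw [hM]; noncomm_ring
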